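/- Let G be a locally triangle-free graph in W₂ with α(G) ≥ 3 such that G is not a join of two proper subgraphs. If v₁v₂ is an edge of G with G_{v₁v₂} = ∅ (every vertex lies in the closed neighborhood of {v₁, v₂}), then v₁ and v₂ have no common neighbor. -/

import Mathlib

open Set

variable {V : Type*}

/-- `S` is an independent set of `G` contained in the vertex subset `W`
(i.e. an independent set of the induced subgraph `G[W]`). -/
def IsIndepOn (G : SimpleGraph V) (W S : Set V) : Prop :=
  S ⊆ W ∧ ∀ ⦃x⦄, x ∈ S → ∀ ⦃y⦄, y ∈ S → ¬ G.Adj x y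

/-- `S` is a maximal independent set of the induced subgraph `G[W]`. -/
def MaxIndepOn (G : SimpleGraph V) (W : Set V) (S : Finset V) : Prop :=
  IsIndepOn G W ↑S ∧ ∀ v ∈ W, v ∉ S → ¬ IsIndepOn G W (insert v ↑S)

/-- The independence number of the induced subgraph `G[W]`. -/
noncomputable def indepNumOn (G : SimpleGraph V) (W : Set V) : ℕ :=
  sSup {n | ∃ S : Finset V, IsIndepOn G W ↑S ∧ S.card = n}

/-- The induced subgraph `G[W]` is well-covered: every maximal independent set
has cardinality equal to the independence number. -/
def WellCoveredOn (G : SimpleGraph V) (W : Set V) : Prop :=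
  ∀ S : Finset V, MaxIndepOn G W S → S.card = indepNumOn G W

/-- The independence number `α(G)`. -/
noncomputable def indepNum (G : SimpleGraph V) : ℕ := indepNumOn G Set.univ

/-- `G` is well-covered. -/
def WellCovered (G : SimpleGraph V) : Prop := WellCoveredOn G Set.univ

/-- The induced subgraph `G[W]` has no isolated vertices. -/
def NoIsolatedOn (G : SimpleGraph V) (W : Set V) : Prop :=
  ∀ v ∈ W, ∃ u ∈ W, G.Adj v u

/-- The induced subgraph `G[W]` is in the class `W₂`: it has no isolated
vertices, is well-covered, and removing any vertex leaves a well-covered graph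
with the same independence number. -/
def W2On (G : SimpleGraph V) (W : Set V) : Prop :=
  NoIsolatedOn G W ∧ WellCoveredOn G W ∧
    ∀ v ∈ W, WellCoveredOn G (W \ {v}) ∧ indepNumOn G (W \ {v}) = indepNumOn G W

/-- `G` is in the class `W₂`. -/
def W2 (G : SimpleGraph V) : Prop := W2On G Set.univ

/-- The closed neighborhood `N_G[S]` of a set of vertices `S`. -/
def nbhd (G : SimpleGraph V) (S : Set V) : Set V :=
  {v | v ∈ S ∨ ∃ u ∈ S, G.Adj u v}

/-- The vertex set of `G_S = G \ N_G[S]`. -/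
def GDel (G : SimpleGraph V) (S : Set V) : Set V := Set.univ \ nbhd G S

/-- The induced subgraph `G[W]` is triangle-free. -/
def TriangleFreeOn (G : SimpleGraph V) (W : Set V) : Prop :=
  ∀ x ∈ W, ∀ y ∈ W, ∀ z ∈ W, ¬ (G.Adj x y ∧ G.Adj y z ∧ G.Adj x z)

/-- `G` is locally triangle-free: `G_v` is triangle-free for every vertex `v`. -/
def LocallyTriangleFree (G : SimpleGraph V) : Prop :=
  ∀ v : V, TriangleFreeOn G (GDel G {v})

/-- `G` is a join of two proper (nonempty, disjoint) subgraphs. -/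
def IsJoin (G : SimpleGraph V) : Prop :=
  ∃ V₁ V₂ : Set V, V₁.Nonempty ∧ V₂.Nonempty ∧ Disjoint V₁ V₂ ∧ V₁ ∪ V₂ = Set.univ ∧
    ∀ x ∈ V₁, ∀ y ∈ V₂, G.Adj x y

theorem LocallyTriangleFree.false_of_triangle {G : SimpleGraph V}
    (h : LocallyTriangleFree G) {p x y z : V}
    (hx : ¬ G.Adj p x) (hy : ¬ G.Adj p y) (hz : ¬ G.Adj p z)
    (hxy : G.Adj x y) (hyz : G.Adj y z) (hxz : G.Adj x z) : False := by
  have key : ∀ w w', G.Adj w w' → ¬ G.Adj p w → ¬ G.Adj p w' → w ∈ GDel G {p} := by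
    rintro w w' hww hw hw'
    refine ⟨mem_univ w, ?_⟩
    rintro (rfl | ⟨u, rfl, hu⟩)
    · exact hw' hww
    · exact hw hu
  exact h p x (key x y hxy hx hy) y (key y z hyz hy hz) z (key z x hxz.symm hz hx)
    ⟨hxy, hyz, hxz⟩

/-- A dominating independent set in a well-covered graph is a maximum one. -/
theorem WellCovered.card_eq {G : SimpleGraph V} (h : WellCovered G) {S : Finset V}
    (hS : ∀ x ∈ S, ∀ y ∈ S, ¬ G.Adj x y) (hdom : ∀ z, z ∉ S → ∃ s ∈ S, G.Adj s z) :
    S.card = indepNum G := by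
  refine h S ⟨⟨subset_univ _, fun x hx y hy => hS x hx y hy⟩, fun v _ hv hi => ?_⟩
  obtain ⟨s, hs, hsv⟩ := hdom v hv
  exact hi.2 (Or.inr hs) (Or.inl rfl) hsv

section Independence

variable [Fintype V] {G : SimpleGraph V}

theorem bddAbove_card_isIndepOn (G : SimpleGraph V) (W : Set V) :
    BddAbove {n | ∃ S : Finset V, IsIndepOn G W ↑S ∧ S.card = n} := by
  refine ⟨Fintype.card V, ?_⟩
  rintro n ⟨S, -, rfl⟩
  exact S.card_le_univ

theorem IsIndepOn.card_le {W : Set V} {S : Finset V} (h : IsIndepOn G W S) :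
    S.card ≤ indepNumOn G W :=
  le_csSup (bddAbove_card_isIndepOn G W) ⟨S, h, rfl⟩

theorem IsIndepOn.exists_maxIndepOn {W : Set V} {S : Finset V} (h : IsIndepOn G W S) :
    ∃ T : Finset V, S ⊆ T ∧ MaxIndepOn G W T := by
  classical
  obtain ⟨T, hST, hT⟩ :=
    (Set.toFinite {T : Finset V | IsIndepOn G W T}).exists_le_maximal h
  refine ⟨T, hST, hT.prop, fun v _ hvT hv => hvT ?_⟩
  have hins : IsIndepOn G W ↑(insert v T) := by simpa using hv
  exact hT.le_of_ge hins (Finset.subset_insert v T) (Finset.mem_insert_self v T)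

/-- In a `W₂` graph, a vertex outside the closed neighborhood of an independent set `S`
has a neighbor outside the closed neighborhood of `S`. -/
theorem W2.exists_adj_forall_not_adj (h : W2 G) {S : Finset V}
    (hS : ∀ x ∈ S, ∀ y ∈ S, ¬ G.Adj x y) {v : V} (hv : v ∉ S)
    (hvS : ∀ s ∈ S, ¬ G.Adj s v) : ∃ u, G.Adj v u ∧ ∀ s ∈ S, ¬ G.Adj s u := by
  classical
  by_contra! hcon
  have hSW : IsIndepOn G (univ \ {v}) S :=
    ⟨fun x hx => ⟨mem_univ x, fun hxv => hv (by simpa using hxv ▸ hx)⟩,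
      fun x hx y hy => hS x hx y hy⟩
  obtain ⟨T, hST, hT⟩ := hSW.exists_maxIndepOn
  have hvT : v ∉ T := fun hvT => (hT.1.1 hvT).2 rfl
  have hadj : ∀ t ∈ T, ¬ G.Adj v t := fun t ht hvt => by
    obtain ⟨s, hs, hst⟩ := hcon t hvt
    exact hT.1.2 (hST hs) ht hst
  have hins : IsIndepOn G univ ↑(insert v T) := by
    refine ⟨subset_univ _, fun x hx y hy hxy => ?_⟩
    simp only [Finset.coe_insert, Set.mem_insert_iff, Finset.mem_coe] at hx hy
    rcases hx with rfl | hx <;> rcases hy with rfl | hy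
    · exact G.irrefl hxy
    · exact hadj y hy hxy
    · exact hadj x hx hxy.symm
    · exact hT.1.2 hx hy hxy
  have hle := hins.card_le
  obtain ⟨hwc, heq⟩ := h.2.2 v (mem_univ v)
  rw [Finset.card_insert_of_notMem hvT, hwc T hT, heq] at hle
  omega

/-- If `α(G) ≥ 3`, the graph obtained by deleting the closed neighborhood of a vertex `p`
is not a join. -/
theorem W2.forall_of_forall_adj (h : W2 G) (hloc : LocallyTriangleFree G)
    (hα : 3 ≤ indepNum G) {p x₀ : V} {P : V → Prop}
    (hadj : ∀ x y, x ≠ p → y ≠ p → ¬ G.Adj p x → ¬ G.Adj p y → P x → ¬ P y → G.Adj x y)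
    (hx₀ : x₀ ≠ p) (hpx₀ : ¬ G.Adj p x₀) (hP : P x₀) {y : V} (hy : y ≠ p)
    (hpy : ¬ G.Adj p y) : P y := by
  classical
  by_contra hPy
  obtain ⟨e, hep, hex, hpe, hxe⟩ :
      ∃ e, e ≠ p ∧ e ≠ x₀ ∧ ¬ G.Adj p e ∧ ¬ G.Adj x₀ e := by
    by_contra! hcon
    have hcard : ({p, x₀} : Finset V).card = indepNum G := by
      refine WellCovered.card_eq h.2.1 ?_ ?_
      · simp [hpx₀, G.adj_comm x₀ p]
      · intro z hz
        simp only [Finset.mem_insert, Finset.mem_singleton, not_or] at hz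
        by_cases hpz : G.Adj p z
        · exact ⟨p, by simp, hpz⟩
        · exact ⟨x₀, by simp, hcon z hz.1 hz.2 hpz⟩
    have := Finset.card_le_two (a := p) (b := x₀)
    omega
  have hPe : P e := by
    by_contra hPe
    exact hxe (hadj x₀ e hx₀ hep hpx₀ hpe hP hPe)
  obtain ⟨u, hxu, hu⟩ := h.exists_adj_forall_not_adj (S := {p, e}) (v := x₀)
    (by simp [hpe, G.adj_comm e p]) (by simp [hx₀, hex.symm])
    (by simp [hpx₀, G.adj_comm e x₀, hxe])
  have hpu : ¬ G.Adj p u := hu p (by simp)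
  have heu : ¬ G.Adj e u := hu e (by simp)
  have hup : u ≠ p := by
    rintro rfl
    exact hpx₀ hxu.symm
  by_cases hPu : P u
  · exact hloc.false_of_triangle hpx₀ hpu hpy hxu (hadj u y hup hy hpu hpy hPu hPy)
      (hadj x₀ y hx₀ hy hpx₀ hpy hP hPy)
  · exact heu (hadj e u hep hup hpe hpu hPe hPu)

/-- For an edge `px` and a vertex `a` adjacent to neither end, there is a set `T` containing `a`
of vertices adjacent to neither end such that `T ∪ {x}` is dominating. -/
theorem W2.exists_dominating (h : W2 G) (hloc : LocallyTriangleFree G) {p x a : V}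
    (hpx : G.Adj p x) (hpa : ¬ G.Adj p a) (hxa : ¬ G.Adj x a) :
    ∃ T : Finset V, a ∈ T ∧ (∀ t ∈ T, ¬ G.Adj p t ∧ ¬ G.Adj x t) ∧
      ∀ z, z ≠ x → ¬ G.Adj x z → z ∉ T → ∃ t ∈ T, G.Adj t z := by
  classical
  have hap : IsIndepOn G {t | ¬ G.Adj p t ∧ ¬ G.Adj x t} ↑({a} : Finset V) := by
    simp [IsIndepOn, hpa, hxa]
  obtain ⟨T, haT, hT⟩ := hap.exists_maxIndepOn
  replace haT : a ∈ T := haT (by simp)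
  have hTi : ∀ s ∈ T, ∀ t ∈ T, ¬ G.Adj s t := fun s hs t ht => hT.1.2 hs ht
  have hTf : ∀ t ∈ T, ¬ G.Adj p t ∧ ¬ G.Adj x t := fun t ht => hT.1.1 ht
  have hcov : ∀ z, z ∉ T → (∀ t ∈ T, ¬ G.Adj t z) → G.Adj p z ∨ G.Adj x z := by
    intro z hz hzT
    by_contra! hcon
    refine hT.2 z hcon hz ⟨?_, ?_⟩
    · rintro w (rfl | hw)
      exacts [hcon, hTf w hw]
    · rintro w (rfl | hw) w' (rfl | hw') hww
      exacts [G.irrefl hww, hzT w' hw' hww.symm, hzT w hw hww, hTi w hw w' hw' hww]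
  refine ⟨T, haT, hTf, fun z hzx hxz hzT => ?_⟩
  by_contra! hzd
  have hpz : G.Adj p z := (hcov z hzT hzd).resolve_right hxz
  let N : V → Finset V := fun q => {w | G.Adj q w ∧ ∀ t ∈ T, ¬ G.Adj t w}
  have hN : ∀ q w, w ∈ N q ↔ G.Adj q w ∧ ∀ t ∈ T, ¬ G.Adj t w := by simp [N]
  have hNT : ∀ q, (∀ t ∈ T, ¬ G.Adj q t) → Disjoint (N q) T := by
    intro q hq
    rw [Finset.disjoint_left]
    exact fun w hw hwT => hq w hwT ((hN q w).1 hw).1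
  have hNi : ∀ q, (∀ t ∈ T, ¬ G.Adj q t) → ∀ w ∈ N q ∪ T, ∀ w' ∈ N q ∪ T, ¬ G.Adj w w' := by
    intro q hq w hw w' hw' hww
    rw [Finset.mem_union, hN] at hw hw'
    rcases hw with hw | hw <;> rcases hw' with hw' | hw'
    · exact hloc.false_of_triangle (fun ha => hq a haT ha.symm) (hw.2 a haT) (hw'.2 a haT)
        hw.1 hww hw'.1
    · exact hw.2 w' hw' hww.symm
    · exact hw'.2 w hw hww
    · exact hTi w hw w' hw' hww
  have hpT : ∀ t ∈ T, ¬ G.Adj p t := fun t ht => (hTf t ht).1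
  have hxT : ∀ t ∈ T, ¬ G.Adj x t := fun t ht => (hTf t ht).2
  have hxN : x ∈ N p := (hN p x).2 ⟨hpx, fun t ht hh => hxT t ht hh.symm⟩
  have hpN : p ∈ N x := (hN x p).2 ⟨hpx.symm, fun t ht hh => hpT t ht hh.symm⟩
  have hzN : z ∈ N p := (hN p z).2 ⟨hpz, hzd⟩
  have hcp : (N p ∪ T).card = indepNum G := by
    refine WellCovered.card_eq h.2.1 (hNi p hpT) fun w hw => ?_
    by_contra! hcon
    rw [Finset.mem_union, not_or, hN] at hw
    have hwT : ∀ t ∈ T, ¬ G.Adj t w := fun t ht => hcon t (Finset.mem_union_right _ ht)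
    rcases hcov w hw.2 hwT with hpw | hxw
    · exact hw.1 ⟨hpw, hwT⟩
    · exact hcon x (Finset.mem_union_left _ hxN) hxw
  have hcx : (N x ∪ T).card = indepNum G := by
    refine WellCovered.card_eq h.2.1 (hNi x hxT) fun w hw => ?_
    by_contra! hcon
    rw [Finset.mem_union, not_or, hN] at hw
    have hwT : ∀ t ∈ T, ¬ G.Adj t w := fun t ht => hcon t (Finset.mem_union_right _ ht)
    rcases hcov w hw.2 hwT with hpw | hxw
    · exact hcon p (Finset.mem_union_left _ hpN) hpw
    · exact hw.1 ⟨hxw, hwT⟩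
  rw [Finset.card_union_of_disjoint (hNT p hpT)] at hcp
  rw [Finset.card_union_of_disjoint (hNT x hxT)] at hcx
  have hpriv : ∀ q ∈ N p, ∃ u ∈ (N x).erase p, G.Adj q u ∧ ∀ s ∈ N p, s ≠ q → ¬ G.Adj s u := by
    intro q hq
    have hqT : q ∉ T := Finset.disjoint_left.1 (hNT p hpT) hq
    obtain ⟨u, hqu, hu⟩ := h.exists_adj_forall_not_adj (S := (N p ∪ T).erase q) (v := q)
      (fun s hs t ht => hNi p hpT s (Finset.mem_of_mem_erase hs) t (Finset.mem_of_mem_erase ht))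
      (Finset.notMem_erase q _)
      (fun s hs => hNi p hpT s (Finset.mem_of_mem_erase hs) q (Finset.mem_union_left _ hq))
    have hu1 : ∀ s ∈ N p, s ≠ q → ¬ G.Adj s u := fun s hs hsq =>
      hu s (Finset.mem_erase.2 ⟨hsq, Finset.mem_union_left _ hs⟩)
    have hu2 : ∀ t ∈ T, ¬ G.Adj t u := fun t ht =>
      hu t (Finset.mem_erase.2 ⟨fun hh => hqT (hh ▸ ht), Finset.mem_union_right _ ht⟩)
    have huT : u ∉ T := fun huT => ((hN p q).1 hq).2 u huT hqu.symm
    have hup : u ≠ p := by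
      rintro rfl
      by_cases hqx : q = x
      · exact hu1 z hzN (hqx ▸ hzx) hpz.symm
      · exact hu1 x hxN (Ne.symm hqx) hpx.symm
    have hpu : ¬ G.Adj p u := fun hpu =>
      hNi p hpT q (Finset.mem_union_left _ hq) u
        (Finset.mem_union_left _ ((hN p u).2 ⟨hpu, hu2⟩)) hqu
    have hxu : G.Adj x u := (hcov u huT hu2).resolve_left hpu
    exact ⟨u, Finset.mem_erase.2 ⟨hup, (hN x u).2 ⟨hxu, hu2⟩⟩, hqu, hu1⟩
  choose! f hf using hpriv
  have hle : (N p).card ≤ ((N x).erase p).card := by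
    refine Finset.card_le_card_of_injOn f (fun q hq => (hf q hq).1) fun q hq q' hq' hqq => ?_
    by_contra hne
    exact (hf q' hq').2.2 q hq hne (hqq ▸ (hf q hq).2.1)
  have := Finset.card_erase_lt_of_mem hpN
  omega

end Independence

section DominatingEdge

variable [Fintype V] {G : SimpleGraph V} {v₁ v₂ : V}

/-- For a dominating edge `v₁v₂`, a vertex `a` not adjacent to `v₁` cannot have both a
non-neighbor `b` not adjacent to `v₂` and a non-neighbor `c` adjacent to `v₁` and `v₂`. -/
theorem W2.adj_of_not_adj_common (h : W2 G) (hloc : LocallyTriangleFree G)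
    (hcov : ∀ z, G.Adj v₁ z ∨ G.Adj v₂ z) {a b c : V} (ha : ¬ G.Adj v₁ a)
    (hb : ¬ G.Adj v₂ b) (hc₁ : G.Adj v₁ c) (hc₂ : G.Adj v₂ c) (hca : ¬ G.Adj c a) :
    G.Adj a b := by
  by_contra hab
  have hv₂a : G.Adj v₂ a := (hcov a).resolve_left ha
  obtain ⟨T, -, hT, hdom⟩ := h.exists_dominating hloc hv₂a hb hab
  obtain ⟨t, ht, htc⟩ := hdom c (fun hh => ha (hh ▸ hc₁)) (fun hh => hca hh.symm)
    (fun hh => (hT c hh).1 hc₂)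
  exact hloc.false_of_triangle (p := a) (fun hh => ha hh.symm) (hT t ht).2
    (fun hh => hca hh.symm) ((hcov t).resolve_right (hT t ht).1) htc hc₁

/-- For a dominating edge `v₁v₂`, a common neighbor of `v₁` and `v₂` cannot have non-neighbors
both outside the neighborhood of `v₁` and outside the neighborhood of `v₂`. -/
theorem W2.common_adj_of_not_adj (h : W2 G) (hloc : LocallyTriangleFree G)
    (hα : 3 ≤ indepNum G) (hcov : ∀ z, G.Adj v₁ z ∨ G.Adj v₂ z) {a b c : V}
    (ha : ¬ G.Adj v₁ a) (hb : ¬ G.Adj v₂ b) (hc₁ : G.Adj v₁ c) (hc₂ : G.Adj v₂ c)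
    (hca : ¬ G.Adj c a) : G.Adj c b := by
  by_contra hcb
  obtain ⟨T, -, hT, hTd⟩ := h.exists_dominating hloc hc₁ ha hca
  obtain ⟨T', -, hT', hTd'⟩ := h.exists_dominating hloc hc₂ hb hcb
  have hadj : ∀ x y, ¬ G.Adj v₁ x → ¬ G.Adj v₂ y → ¬ G.Adj c x → G.Adj x y :=
    fun x y hx hy hcx => h.adj_of_not_adj_common hloc hcov hx hy hc₁ hc₂ hcx
  have hbP : ¬ G.Adj v₁ b := by
    refine h.forall_of_forall_adj hloc hα (p := c) (x₀ := a)
      (P := fun w => ¬ G.Adj v₁ w) ?_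
      (fun hh => ha (hh ▸ hc₁)) hca ha (fun hh => hb (hh ▸ hc₂)) hcb
    intro x y _ hyc hcx hcy hx hy
    rw [not_not] at hy
    by_cases hy₂ : G.Adj v₂ y
    · exfalso
      obtain ⟨t, ht, hty⟩ := hTd y hyc hcy (fun hh => (hT y hh).1 hy)
      obtain ⟨t', ht', hty'⟩ := hTd' y hyc hcy (fun hh => (hT' y hh).1 hy₂)
      exact hloc.false_of_triangle (hT t ht).2 (hT' t' ht').2 hcy
        (hadj t t' (hT t ht).1 (hT' t' ht').1 (hT t ht).2) hty' hty
    · exact hadj x y hx hy₂ hcx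
  exact hb ((hcov b).resolve_left hbP)

/-- For a dominating edge `v₁v₂`, if one vertex outside the closed neighborhood of `v₁` has a
non-neighbor among the common neighbors of `v₁` and `v₂`, then all such vertices do. -/
theorem W2.exists_common_not_adj (h : W2 G) (hloc : LocallyTriangleFree G)
    (hα : 3 ≤ indepNum G) (hcov : ∀ z, G.Adj v₁ z ∨ G.Adj v₂ z)
    {a a' c : V} (hav : a ≠ v₁) (ha : ¬ G.Adj v₁ a)
    (hc₁ : G.Adj v₁ c) (hc₂ : G.Adj v₂ c) (hca : ¬ G.Adj c a)
    (hav' : a' ≠ v₁) (ha' : ¬ G.Adj v₁ a') :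
    ∃ d, G.Adj v₁ d ∧ G.Adj v₂ d ∧ ¬ G.Adj d a' := by
  classical
  refine h.forall_of_forall_adj hloc hα (p := v₁)
    (P := fun w => ∃ d, G.Adj v₁ d ∧ G.Adj v₂ d ∧ ¬ G.Adj d w) ?_ hav ha
    ⟨c, hc₁, hc₂, hca⟩ hav' ha'
  rintro x y hxv hyv hx hy ⟨d, hd₁, hd₂, hdx⟩ hP
  by_contra hxy
  obtain ⟨u, hu, huS⟩ := h.exists_adj_forall_not_adj (S := {x, y}) (v := v₁)
    (by simp [hxy, G.adj_comm y x]) (by simp [hxv.symm, hyv.symm])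
    (by simp [G.adj_comm x v₁, G.adj_comm y v₁, hx, hy])
  have hxu : ¬ G.Adj x u := huS x (by simp)
  have hyu : ¬ G.Adj y u := huS y (by simp)
  by_cases hu₂ : G.Adj v₂ u
  · exact hP ⟨u, hu, hu₂, fun hh => hyu hh.symm⟩
  · exact hxu (h.adj_of_not_adj_common hloc hcov hx hu₂ hd₁ hd₂ hdx)

/-- For a dominating edge `v₁v₂`, let `d` be a common neighbor of `v₁` and `v₂` adjacent to all
vertices outside the closed neighborhood of `v₁`. If `d` has a non-neighbor among the common
neighbors without this property, then all its non-neighbors are of this kind. -/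
theorem W2.not_adj_of_not_adj_common (h : W2 G) (hloc : LocallyTriangleFree G)
    (hα : 3 ≤ indepNum G) (hcov : ∀ z, G.Adj v₁ z ∨ G.Adj v₂ z)
    {c d y : V} (hd₁ : G.Adj v₁ d) (hd₂ : G.Adj v₂ d) (hd : ∀ a, ¬ G.Adj v₁ a → G.Adj d a)
    (hc₁ : G.Adj v₁ c) (hc₂ : G.Adj v₂ c) (hc : ∃ a, ¬ G.Adj v₁ a ∧ ¬ G.Adj c a)
    (hdc : ¬ G.Adj d c) (hyd : y ≠ d) (hdy : ¬ G.Adj d y) :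
    G.Adj v₁ y ∧ G.Adj v₂ y ∧ ∃ a, ¬ G.Adj v₁ a ∧ ¬ G.Adj y a := by
  classical
  refine h.forall_of_forall_adj hloc hα (p := d)
    (P := fun w => G.Adj v₁ w ∧ G.Adj v₂ w ∧ ∃ a, ¬ G.Adj v₁ a ∧ ¬ G.Adj w a) ?_
    ?_ hdc ⟨hc₁, hc₂, hc⟩ hyd hdy
  · rintro x w hxd hwd hdx hdw ⟨hx₁, hx₂, a, ha, hxa⟩ hw
    by_contra hxw
    have hw₁ : G.Adj v₁ w := by
      by_contra hw₁
      exact hdw (hd w hw₁)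
    have hw₂ : G.Adj v₂ w := by
      by_contra hw₂
      exact hxw (h.common_adj_of_not_adj hloc hα hcov ha hw₂ hx₁ hx₂ hxa)
    have hwa : ∀ a, ¬ G.Adj v₁ a → G.Adj w a := by
      by_contra! hcon
      exact hw ⟨hw₁, hw₂, hcon⟩
    obtain ⟨T, -, hT, hTd⟩ := h.exists_dominating hloc hx₁ ha hxa
    obtain ⟨u, hdu, hu⟩ := h.exists_adj_forall_not_adj (S := {x, w}) (v := d)
      (by simp [hxw, G.adj_comm w x]) (by simp [hxd.symm, hwd.symm])
      (by simp [G.adj_comm x d, G.adj_comm w d, hdx, hdw])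
    have hxu : ¬ G.Adj x u := hu x (by simp)
    have hwu : ¬ G.Adj w u := hu w (by simp)
    obtain ⟨t, ht, htu⟩ := hTd u (fun hh => hdx (hh ▸ hdu)) hxu
      (fun hh => hwu (hwa u (hT u hh).1))
    exact hloc.false_of_triangle (p := x) (fun hh => hdx hh.symm) (hT t ht).2 hxu
      (hd t (hT t ht).1) htu hdu
  · rintro rfl
    obtain ⟨a, ha, hca⟩ := hc
    exact hca (hd a ha)

/-- For a dominating edge `v₁v₂`, if `G` is not a join, then the common neighbors of `v₁` and `v₂`
are adjacent to all vertices outside the closed neighborhood of `v₁`. -/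
theorem W2.common_adj_of_not_isJoin (h : W2 G) (hloc : LocallyTriangleFree G)
    (hα : 3 ≤ indepNum G) (hjoin : ¬ IsJoin G) (h12 : G.Adj v₁ v₂)
    (hcov : ∀ z, G.Adj v₁ z ∨ G.Adj v₂ z) {a c : V} (ha : ¬ G.Adj v₁ a)
    (hc₁ : G.Adj v₁ c) (hc₂ : G.Adj v₂ c) : G.Adj c a := by
  by_contra hca
  have hav : a ≠ v₁ := fun hh => hca (hh ▸ hc₁.symm)
  let M : V → Prop := fun w => G.Adj v₁ w ∧ G.Adj v₂ w ∧ ∃ a, ¬ G.Adj v₁ a ∧ ¬ G.Adj w a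
  let D : V → Prop := fun w =>
    G.Adj v₁ w ∧ G.Adj v₂ w ∧ (∀ a, ¬ G.Adj v₁ a → G.Adj w a) ∧ ∃ m, M m ∧ ¬ G.Adj w m
  refine hjoin ⟨{w | ¬ G.Adj v₁ w ∨ M w ∨ D w}, {w | ¬ G.Adj v₁ w ∨ M w ∨ D w}ᶜ, ⟨a, Or.inl ha⟩,
    ⟨v₂, ?_⟩, disjoint_compl_right, Set.union_compl_self _, ?_⟩
  · rintro (hv | hv | hv)
    exacts [hv h12, G.irrefl hv.2.1, G.irrefl hv.2.1]
  intro x hx y hy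
  simp only [Set.mem_compl_iff, Set.mem_ofPred_eq, not_or, not_not] at hx hy
  obtain ⟨hy₁, hyM, hyD⟩ := hy
  rcases hx with hx | hx | hx
  · by_cases hxv : x = v₁
    · exact hxv ▸ hy₁
    by_cases hy₂ : G.Adj v₂ y
    · by_contra hxy
      exact hyM ⟨hy₁, hy₂, x, hx, fun hh => hxy hh.symm⟩
    · obtain ⟨d, hd₁, hd₂, hdx⟩ :=
        h.exists_common_not_adj hloc hα hcov hav ha hc₁ hc₂ hca hxv hx
      exact h.adj_of_not_adj_common hloc hcov hx hy₂ hd₁ hd₂ hdx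
  · obtain ⟨hx₁, hx₂, a', ha', hxa'⟩ := id hx
    by_cases hy₂ : G.Adj v₂ y
    · by_contra hxy
      refine hyD ⟨hy₁, hy₂, fun b hb => ?_, x, hx, fun hh => hxy hh.symm⟩
      by_contra hyb
      exact hyM ⟨hy₁, hy₂, b, hb, hyb⟩
    · exact h.common_adj_of_not_adj hloc hα hcov ha' hy₂ hx₁ hx₂ hxa'
  · obtain ⟨hx₁, hx₂, hxA, m, hm, hxm⟩ := id hx
    by_contra hxy
    refine hyM (h.not_adj_of_not_adj_common hloc hα hcov hx₁ hx₂ hxA hm.1 hm.2.1 hm.2.2 hxm ?_ hxy)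
    rintro rfl
    exact hyD hx

end DominatingEdge

/-- If `G` is locally triangle-free in `W₂`, `α(G) ≥ 3`, `G` is not a join, and
`v₁v₂` is an edge with `G_{v₁v₂} = ∅`, then `v₁` and `v₂` have no common
neighbor. -/
theorem stmt_12 [Fintype V] (G : SimpleGraph V) (h2 : W2 G)
    (hloc : LocallyTriangleFree G) (hα : 3 ≤ indepNum G) (hjoin : ¬ IsJoin G)
    {v₁ v₂ : V} (h12 : G.Adj v₁ v₂) (hempty : GDel G {v₁, v₂} = ∅) :
    G.neighborSet v₁ ∩ G.neighborSet v₂ = ∅ := by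
  have hcov : ∀ z, G.Adj v₁ z ∨ G.Adj v₂ z := by
    intro z
    have hz : z ∈ nbhd G {v₁, v₂} := by
      by_contra hz
      exact (hempty ▸ (⟨mem_univ z, hz⟩ : z ∈ GDel G {v₁, v₂}) : z ∈ (∅ : Set V))
    rcases hz with (rfl | rfl) | ⟨u, rfl | rfl, hu⟩
    exacts [Or.inr h12.symm, Or.inl h12, Or.inl hu, Or.inr hu]
  rw [Set.eq_empty_iff_forall_notMem]
  rintro w hw
  refine hjoin ⟨G.neighborSet v₁ ∩ G.neighborSet v₂, (G.neighborSet v₁ ∩ G.neighborSet v₂)ᶜ,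
    ⟨w, hw⟩, ⟨v₁, fun hh => G.irrefl hh.1⟩, disjoint_compl_right, Set.union_compl_self _, ?_⟩
  rintro x ⟨hx₁, hx₂⟩ y hy
  by_cases hy₁ : G.Adj v₁ y
  · exact h2.common_adj_of_not_isJoin hloc hα hjoin h12.symm (fun z => (hcov z).symm)
      (fun hy₂ => hy ⟨hy₁, hy₂⟩) hx₂ hx₁
  · exact h2.common_adj_of_not_isJoin hloc hα hjoin h12 hcov hy₁ hx₁ hx₂
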